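/- Let X, Y be Polish spaces and let μ ∈ P(X)^d, ν ∈ P(Y)^d be d-tuples of Borel probability measures such that both Π(μ,ν) and Π(ν,μ) are nonempty. Let c : X×Y → [0,∞) be uniformly continuous and bounded. Then duality holds: inf_{π ∈ Π(μ,ν)} ∫_{X×Y} c dπ = sup { ∫_X φ dμ̄ + ∫_Y ψ dν̄ : φ ∈ L¹(μ̄), ψ ∈ L¹(ν̄), and φ(x) + ψ(y) ≤ c(x,y) for all (x,y) ∈ X×Y with μ'(x) = ν'(y) }, where μ', ν' are fixed Borel versions of the density vectors. Moreover, both the infimum and the supremum are attained. -/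

import Mathlib

open MeasureTheory ProbabilityTheory ENNReal

noncomputable section

/-- Average probability measure of a `d`-tuple of probability measures. -/
def avgProb {X : Type*} [MeasurableSpace X] {d : ℕ} (μ : Fin d → Measure X) : Measure X :=
  (d : ℝ≥0∞)⁻¹ • ∑ j, μ j

/-- Vector of Radon–Nikodym derivatives of the tuple with respect to the average. -/
def densityVec {X : Type*} [MeasurableSpace X] {d : ℕ} (μ : Fin d → Measure X) (x : X) :
    Fin d → ℝ :=
  fun j => ((μ j).rnDeriv (avgProb μ) x).toReal

/-- The set `Π(μ,ν) = {μ̄ ⊗ κ : κ ∈ K(μ,ν)}` of simultaneous transport plans. -/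
def PiSet {X Y : Type*} [MeasurableSpace X] [MeasurableSpace Y] {d : ℕ}
    (μ : Fin d → Measure X) (ν : Fin d → Measure Y) : Set (Measure (X × Y)) :=
  {π | ∃ κ : Kernel X Y, IsMarkovKernel κ ∧
    (∀ j, ∀ B : Set Y, MeasurableSet B → ν j B ≤ ∫⁻ x, κ x B ∂(μ j)) ∧
    π = (avgProb μ).compProd κ}

/-- Admissible dual pairs: integrable potentials `φ, ψ` with `φ(x) + ψ(y) ≤ c(x,y)`
whenever `μ'(x) = ν'(y)`. -/
def DualAdmissible {X Y : Type*} [MeasurableSpace X] [MeasurableSpace Y] {d : ℕ}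
    (μ : Fin d → Measure X) (ν : Fin d → Measure Y) (c : X × Y → ℝ)
    (φ : X → ℝ) (ψ : Y → ℝ) : Prop :=
  Integrable φ (avgProb μ) ∧ Integrable ψ (avgProb ν) ∧
    ∀ x y, densityVec μ x = densityVec ν y → φ x + ψ y ≤ c (x, y)

open Filter Topology Set

/-- A positively homogeneous superadditive function is supported from above, at any prescribed
point, by a linear functional. -/
lemma exists_linearMap_ge_superlinear {E : Type*} [AddCommGroup E] [Module ℝ E] (q : E → ℝ)
    (q_hom : ∀ t : ℝ, 0 < t → ∀ x, q (t • x) = t * q x)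
    (q_add : ∀ x y, q x + q y ≤ q (x + y)) (c : E) :
    ∃ L : E →ₗ[ℝ] ℝ, (∀ x, q x ≤ L x) ∧ L c = q c := by
  have q_zero : q 0 = 0 := by grind [q_hom 2 (by norm_num) 0, smul_zero]
  have hc : ∀ t : ℝ, t • c = 0 → t • q c = 0 := by
    intro t ht
    rcases smul_eq_zero.1 ht with h | h
    · simp [h]
    · simp [h, q_zero]
  obtain ⟨L, hL, hLN⟩ := exists_extension_of_le_sublinear
    (LinearPMap.mkSpanSingleton' c (q c) hc) (fun x => - q (-x))
    (fun t ht x => by rw [← smul_neg, q_hom t ht]; ring)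
    (fun x y => by have := q_add (-x) (-y); rw [neg_add]; linarith)
    (by
      rintro ⟨x, hx⟩
      obtain ⟨t, rfl⟩ := Submodule.mem_span_singleton.1 hx
      rw [LinearPMap.mkSpanSingleton'_apply]
      simp only [RingHom.id_apply, smul_eq_mul]
      rcases lt_trichotomy t 0 with ht | rfl | ht
      · rw [← neg_smul, q_hom (-t) (by linarith)]; linarith
      · simp [q_zero]
      · have h := q_add (t • c) (-(t • c))
        rw [add_neg_cancel, q_zero, q_hom t ht] at h
        linarith)
  refine ⟨L, fun x => ?_, ?_⟩
  · have := hLN (-x)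
    simp only [map_neg, neg_neg] at this
    linarith
  · exact (hL ⟨c, Submodule.mem_span_singleton_self c⟩).trans
      (LinearPMap.mkSpanSingleton'_apply_self c (q c) hc _)

/-- A coupling of `m` and `n` concentrated on the fibre product `{(x, y) | f x = g y}`. -/
structure IsFiberCoupling {X Y Z : Type*} [MeasurableSpace X] [MeasurableSpace Y]
    (m : Measure X) (n : Measure Y) (f : X → Z) (g : Y → Z) (π : Measure (X × Y)) : Prop where
  fst : π.fst = m
  snd : π.snd = n
  ae_eq : ∀ᵐ p ∂π, f p.1 = g p.2

/-- Integrable potentials whose sum is at most `h` on the fibre product `{(x, y) | f x = g y}`. -/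
structure IsPotentialPair {X Y Z : Type*} [MeasurableSpace X] [MeasurableSpace Y]
    (m : Measure X) (n : Measure Y) (f : X → Z) (g : Y → Z) (h : X × Y → ℝ)
    (φ : X → ℝ) (ψ : Y → ℝ) : Prop where
  fst : Integrable φ m
  snd : Integrable ψ n
  le : ∀ x y, f x = g y → φ x + ψ y ≤ h (x, y)

/-- The values of the dual problem with cost `h`. -/
def dualValues {X Y Z : Type*} [MeasurableSpace X] [MeasurableSpace Y]
    (m : Measure X) (n : Measure Y) (f : X → Z) (g : Y → Z) (h : X × Y → ℝ) : Set ℝ :=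
  {r | ∃ φ ψ, IsPotentialPair m n f g h φ ψ ∧ r = ∫ x, φ x ∂m + ∫ y, ψ y ∂n}

/-- A linear functional on functions on `X × Y` which dominates all dual values. -/
def DominatesDual {X Y Z : Type*} [MeasurableSpace X] [MeasurableSpace Y]
    (m : Measure X) (n : Measure Y) (f : X → Z) (g : Y → Z) (L : (X × Y → ℝ) →ₗ[ℝ] ℝ) : Prop :=
  ∀ h : X × Y → ℝ, (∃ C, ∀ p, |h p| ≤ C) → ∀ r ∈ dualValues m n f g h, r ≤ L h

section Potentials

variable {X Y Z : Type*} [MeasurableSpace X] [MeasurableSpace Y]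
  {m : Measure X} {n : Measure Y} {f : X → Z} {g : Y → Z}

lemma IsFiberCoupling.integral_fst {π : Measure (X × Y)} (hπ : IsFiberCoupling m n f g π)
    {φ : X → ℝ} (hφ : Integrable φ m) :
    Integrable (fun p : X × Y => φ p.1) π ∧ ∫ p, φ p.1 ∂π = ∫ x, φ x ∂m := by
  rw [← hπ.fst, Measure.fst] at hφ ⊢
  exact ⟨hφ.comp_measurable measurable_fst,
    (integral_map measurable_fst.aemeasurable hφ.aestronglyMeasurable).symm⟩

lemma IsFiberCoupling.integral_snd {π : Measure (X × Y)} (hπ : IsFiberCoupling m n f g π)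
    {ψ : Y → ℝ} (hψ : Integrable ψ n) :
    Integrable (fun p : X × Y => ψ p.2) π ∧ ∫ p, ψ p.2 ∂π = ∫ y, ψ y ∂n := by
  rw [← hπ.snd, Measure.snd] at hψ ⊢
  exact ⟨hψ.comp_measurable measurable_snd,
    (integral_map measurable_snd.aemeasurable hψ.aestronglyMeasurable).symm⟩

/-- Weak duality. -/
lemma IsFiberCoupling.dualValue_le {π : Measure (X × Y)} (hπ : IsFiberCoupling m n f g π)
    {h k : X × Y → ℝ} (hk : Integrable k π) (hhk : ∀ p, h p ≤ k p) {r : ℝ}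
    (hr : r ∈ dualValues m n f g h) : r ≤ ∫ p, k p ∂π := by
  obtain ⟨φ, ψ, hφψ, rfl⟩ := hr
  obtain ⟨h1, e1⟩ := hπ.integral_fst hφψ.fst
  obtain ⟨h2, e2⟩ := hπ.integral_snd hφψ.snd
  rw [← e1, ← e2, ← integral_add h1 h2]
  refine integral_mono_ae (h1.add h2) hk ?_
  filter_upwards [hπ.ae_eq] with p hp
  exact (hφψ.le p.1 p.2 hp).trans (hhk p)

lemma dualValues_add {h k : X × Y → ℝ} {r s : ℝ} (hr : r ∈ dualValues m n f g h)
    (hs : s ∈ dualValues m n f g k) : r + s ∈ dualValues m n f g (h + k) := by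
  obtain ⟨φ, ψ, H, rfl⟩ := hr
  obtain ⟨φ', ψ', H', rfl⟩ := hs
  refine ⟨φ + φ', ψ + ψ', ⟨H.fst.add H'.fst, H.snd.add H'.snd, fun x y e => ?_⟩, ?_⟩
  · have := H.le x y e
    have := H'.le x y e
    simp only [Pi.add_apply]
    linarith
  · rw [integral_add' H.fst H'.fst, integral_add' H.snd H'.snd]
    ring

lemma dualValues_smul {h : X × Y → ℝ} {r t : ℝ} (ht : 0 ≤ t) (hr : r ∈ dualValues m n f g h) :
    t * r ∈ dualValues m n f g (t • h) := by
  obtain ⟨φ, ψ, H, rfl⟩ := hr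
  refine ⟨t • φ, t • ψ, ⟨H.fst.smul t, H.snd.smul t, fun x y e => ?_⟩, ?_⟩
  · have := mul_le_mul_of_nonneg_left (H.le x y e) ht
    simpa [mul_add] using this
  · simp only [Pi.smul_apply, smul_eq_mul, integral_const_mul]
    ring

lemma dualValues_nonempty [IsFiniteMeasure m] [IsFiniteMeasure n] {h : X × Y → ℝ}
    (hh : ∃ C, ∀ p, |h p| ≤ C) :
    (dualValues m n f g h).Nonempty := by
  obtain ⟨C, hC⟩ := hh
  refine ⟨_, fun _ => -C, fun _ => 0, ⟨integrable_const _, integrable_const _, fun x y _ => ?_⟩,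
    rfl⟩
  have := abs_le.1 (hC (x, y))
  simpa using this.1

lemma IsFiberCoupling.isProbabilityMeasure [IsProbabilityMeasure m] {π : Measure (X × Y)}
    (hπ : IsFiberCoupling m n f g π) : IsProbabilityMeasure π :=
  ⟨by rw [← Measure.fst_univ, hπ.fst, measure_univ]⟩

lemma IsFiberCoupling.bddAbove_dualValues [IsProbabilityMeasure m] {π : Measure (X × Y)}
    (hπ : IsFiberCoupling m n f g π) {h : X × Y → ℝ} (hh : ∃ C, ∀ p, |h p| ≤ C) :
    BddAbove (dualValues m n f g h) := by
  obtain ⟨C, hC⟩ := hh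
  have := hπ.isProbabilityMeasure
  exact ⟨_, fun r hr => hπ.dualValue_le (integrable_const C) (fun p => (abs_le.1 (hC p)).2) hr⟩

/-- If there is a fibre coupling, there is a linear functional that dominates all dual values and
attains the supremum of the dual values at a prescribed bounded cost. -/
lemma IsFiberCoupling.exists_dominatesDual [IsProbabilityMeasure m] [IsProbabilityMeasure n]
    {π : Measure (X × Y)} (hπ : IsFiberCoupling m n f g π) {c : X × Y → ℝ}
    (hc : ∃ C, ∀ p, |c p| ≤ C) :
    ∃ L : (X × Y → ℝ) →ₗ[ℝ] ℝ, DominatesDual m n f g L ∧ L c = sSup (dualValues m n f g c) := by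
  let E : Submodule ℝ (X × Y → ℝ) :=
    { carrier := {h | ∃ C, ∀ p, |h p| ≤ C}
      zero_mem' := ⟨0, by simp⟩
      add_mem' := by
        rintro a b ⟨C, hC⟩ ⟨D, hD⟩
        exact ⟨C + D, fun p => (abs_add_le _ _).trans (add_le_add (hC p) (hD p))⟩
      smul_mem' := by
        rintro t a ⟨C, hC⟩
        refine ⟨|t| * C, fun p => ?_⟩
        rw [Pi.smul_apply, smul_eq_mul, abs_mul]
        exact mul_le_mul_of_nonneg_left (hC p) (abs_nonneg t) }
  have hle : ∀ t : ℝ, 0 < t → ∀ x : E,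
      t * sSup (dualValues m n f g x) ≤ sSup (dualValues m n f g (t • x : E)) := by
    intro t ht x
    rw [mul_comm, ← le_div_iff₀ ht]
    refine csSup_le (dualValues_nonempty x.2) fun r hr => ?_
    rw [le_div_iff₀ ht, mul_comm]
    exact le_csSup (hπ.bddAbove_dualValues (t • x).2) (dualValues_smul ht.le hr)
  obtain ⟨L, hL, hLc⟩ := exists_linearMap_ge_superlinear
    (fun x : E => sSup (dualValues m n f g x))
    (by
      intro t ht x
      refine le_antisymm ?_ (hle t ht x)
      have := hle t⁻¹ (inv_pos.2 ht) (t • x)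
      rw [smul_smul, inv_mul_cancel₀ ht.ne', one_smul, inv_mul_le_iff₀ ht] at this
      exact this)
    (by
      intro x y
      rw [← le_sub_iff_add_le]
      refine csSup_le (dualValues_nonempty x.2) fun r hr => ?_
      rw [le_sub_iff_add_le, add_comm, ← le_sub_iff_add_le]
      refine csSup_le (dualValues_nonempty y.2) fun s hs => ?_
      rw [le_sub_iff_add_le, add_comm]
      exact le_csSup (hπ.bddAbove_dualValues (x + y).2) (dualValues_add hr hs))
    ⟨c, hc⟩
  obtain ⟨L', hL'⟩ := LinearMap.exists_extend L
  have key : ∀ x : E, L' x = L x := fun x => by rw [← hL']; rfl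
  refine ⟨L', fun h hh r hr => ?_, ?_⟩
  · rw [key ⟨h, hh⟩]
    exact (le_csSup (hπ.bddAbove_dualValues hh) hr).trans (hL ⟨h, hh⟩)
  · rw [key ⟨c, hc⟩]
    exact hLc

end Potentials


section DominatesDual

variable {X Y Z : Type*} [MeasurableSpace X] [MeasurableSpace Y]
  {m : Measure X} {n : Measure Y} {f : X → Z} {g : Y → Z}
  [IsProbabilityMeasure m] [IsProbabilityMeasure n] {L : (X × Y → ℝ) →ₗ[ℝ] ℝ}

lemma Measurable.integrable_of_abs_le {Ω : Type*} [MeasurableSpace Ω] {μ : Measure Ω}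
    [IsFiniteMeasure μ] {u : Ω → ℝ} (hu : Measurable u) {C : ℝ} (hC : ∀ x, |u x| ≤ C) :
    Integrable u μ :=
  Integrable.of_bound hu.aestronglyMeasurable C (Eventually.of_forall hC)

omit [IsProbabilityMeasure m] [IsProbabilityMeasure n] in
lemma DominatesDual.nonneg_of_fiber (hL : DominatesDual m n f g L) {h : X × Y → ℝ}
    (hh : ∃ C, ∀ p, |h p| ≤ C) (h0 : ∀ x y, f x = g y → 0 ≤ h (x, y)) : 0 ≤ L h :=
  hL h hh 0 ⟨0, 0, ⟨integrable_zero _ _ _, integrable_zero _ _ _, by simpa using h0⟩, by simp⟩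

lemma exists_abs_sum_le {X Y : Type*} {φ : X → ℝ} {ψ : Y → ℝ} (hφ : ∃ C, ∀ x, |φ x| ≤ C)
    (hψ : ∃ C, ∀ y, |ψ y| ≤ C) : ∃ C, ∀ p : X × Y, |φ p.1 + ψ p.2| ≤ C := by
  obtain ⟨C, hC⟩ := hφ
  obtain ⟨D, hD⟩ := hψ
  exact ⟨C + D, fun p => (abs_add_le _ _).trans (add_le_add (hC _) (hD _))⟩

lemma DominatesDual.map_sum (hL : DominatesDual m n f g L) {φ : X → ℝ} {ψ : Y → ℝ}
    (hφm : Measurable φ) (hφ : ∃ C, ∀ x, |φ x| ≤ C)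
    (hψm : Measurable ψ) (hψ : ∃ C, ∀ y, |ψ y| ≤ C) :
    L (fun p => φ p.1 + ψ p.2) = ∫ x, φ x ∂m + ∫ y, ψ y ∂n := by
  have hb := exists_abs_sum_le hφ hψ
  obtain ⟨C, hC⟩ := hφ
  obtain ⟨D, hD⟩ := hψ
  have i1 : Integrable φ m := hφm.integrable_of_abs_le hC
  have i2 : Integrable ψ n := hψm.integrable_of_abs_le hD
  refine le_antisymm ?_ (hL _ hb _ ⟨φ, ψ, ⟨i1, i2, fun _ _ _ => le_rfl⟩, rfl⟩)
  have := hL (-fun p => φ p.1 + ψ p.2) (by simpa only [Pi.neg_apply, abs_neg] using hb) _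
    ⟨-φ, -ψ, ⟨i1.neg, i2.neg, fun x y _ => by simp [add_comm]⟩, rfl⟩
  rw [map_neg, integral_neg', integral_neg'] at this
  linarith

omit [IsProbabilityMeasure m] [IsProbabilityMeasure n] in
lemma DominatesDual.mono (hL : DominatesDual m n f g L) {h k : X × Y → ℝ}
    (hh : ∃ C, ∀ p, |h p| ≤ C) (hk : ∃ C, ∀ p, |k p| ≤ C) (hhk : ∀ p, h p ≤ k p) :
    L h ≤ L k := by
  obtain ⟨C, hC⟩ := hh
  obtain ⟨D, hD⟩ := hk
  have := hL.nonneg_of_fiber (h := k - h)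
    ⟨D + C, fun p => (abs_sub _ _).trans (add_le_add (hD p) (hC p))⟩
    (fun x y _ => sub_nonneg.2 (hhk (x, y)))
  rw [map_sub] at this
  linarith

lemma DominatesDual.abs_le (hL : DominatesDual m n f g L) {h : X × Y → ℝ}
    {φ : X → ℝ} {ψ : Y → ℝ} (hφm : Measurable φ) (hφ : ∃ C, ∀ x, |φ x| ≤ C)
    (hψm : Measurable ψ) (hψ : ∃ C, ∀ y, |ψ y| ≤ C)
    (hle : ∀ p, |h p| ≤ φ p.1 + ψ p.2) : |L h| ≤ ∫ x, φ x ∂m + ∫ y, ψ y ∂n := by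
  have hb := exists_abs_sum_le hφ hψ
  have hh : ∃ C, ∀ p, |h p| ≤ C := hb.imp fun C hC p =>
    (hle p).trans ((le_abs_self _).trans (hC p))
  rw [← hL.map_sum hφm hφ hψm hψ, _root_.abs_le]
  constructor
  · rw [← map_neg]
    exact hL.mono (by simpa only [Pi.neg_apply, abs_neg] using hb) hh
      fun p => (_root_.abs_le.1 (hle p)).1
  · exact hL.mono hh hb fun p => (_root_.abs_le.1 (hle p)).2

end DominatesDual

/-- Every standard Borel space embeds measurably into the Cantor space. -/
lemma exists_measurableEmbedding_cantor (X : Type*) [MeasurableSpace X] [StandardBorelSpace X] :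
    ∃ i : X → (ℕ → Bool), MeasurableEmbedding i := by
  obtain ⟨i, hi, hinj⟩ := MeasurableSpace.measurable_injection_nat_bool_of_countablySeparated X
  exact ⟨i, hi.measurableEmbedding hinj⟩

section Representation

variable {X Y Z : Type*} [MeasurableSpace X] [MeasurableSpace Y]
  {m : Measure X} {n : Measure Y} {f : X → Z} {g : Y → Z}
  [IsProbabilityMeasure m] [IsProbabilityMeasure n] {L : (X × Y → ℝ) →ₗ[ℝ] ℝ}

omit [IsProbabilityMeasure m] [IsProbabilityMeasure n] in
open CompactlySupported in
/-- Riesz representation of a functional after embedding the factors into compact spaces. -/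
lemma DominatesDual.exists_measure_integral_eq {K K' : Type*}
    [TopologicalSpace K] [CompactSpace K] [T2Space K]
    [TopologicalSpace K'] [CompactSpace K'] [T2Space K']
    [MeasurableSpace (K × K')] [BorelSpace (K × K')]
    (hL : DominatesDual m n f g L) (i : X → K) (j : Y → K') :
    ∃ π : Measure (K × K'), IsFiniteMeasure π ∧
      ∀ u : K × K' → ℝ, Continuous u → ∫ p, u p ∂π = L fun p => u (i p.1, j p.2) := by
  have hbd : ∀ u : K × K' → ℝ, Continuous u → ∃ C, ∀ p : X × Y, |u (i p.1, j p.2)| ≤ C := by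
    intro u hu
    obtain ⟨C, hC⟩ := isCompact_univ.exists_bound_of_continuousOn hu.continuousOn
    exact ⟨C, fun p => hC _ (mem_univ _)⟩
  let Λ₀ : C_c(K × K', ℝ) →ₗ[ℝ] ℝ :=
    { toFun := fun u => L fun p => u (i p.1, j p.2)
      map_add' := fun u v => by rw [← map_add]; rfl
      map_smul' := fun t u => by rw [RingHom.id_apply, ← map_smul]; rfl }
  let Λ : C_c(K × K', ℝ) →ₚ[ℝ] ℝ := PositiveLinearMap.mk₀ Λ₀ fun u hu =>
    hL.nonneg_of_fiber (hbd u u.continuous) fun x y _ => hu _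
  refine ⟨RealRMK.rieszMeasure Λ, inferInstance, fun u hu => ?_⟩
  exact RealRMK.integral_rieszMeasure Λ
    ⟨⟨u, hu⟩, HasCompactSupport.of_compactSpace _⟩

omit [IsProbabilityMeasure m] in
/-- Indicators are `L¹`-approximated by continuous functions of an embedding. -/
lemma exists_continuous_integral_abs_sub_le [IsFiniteMeasure m] {K : Type*} [TopologicalSpace K]
    [MeasurableSpace K] [BorelSpace K] [CompactSpace K] [TopologicalSpace.MetrizableSpace K]
    {i : X → K} (hi : MeasurableEmbedding i) {A : Set X} (hA : MeasurableSet A) {ε : ℝ}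
    (hε : 0 < ε) :
    ∃ u : K → ℝ, Continuous u ∧ (∃ C, 0 ≤ C ∧ ∀ k, |u k| ≤ C) ∧
      ∫ x, |A.indicator 1 x - u (i x)| ∂m ≤ ε := by
  have hA' : MeasurableSet (i '' A) := hi.measurableSet_image.2 hA
  have hint : Integrable ((i '' A).indicator (1 : K → ℝ)) (m.map i) :=
    (integrable_const (1 : ℝ)).indicator hA'
  obtain ⟨u, hu, -⟩ := hint.exists_boundedContinuous_integral_sub_le hε
  refine ⟨u, u.continuous, ⟨‖u‖, norm_nonneg _, fun k => u.norm_coe_le_norm k⟩, ?_⟩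
  rw [hi.integral_map] at hu
  refine le_of_eq_of_le (integral_congr_ae (Eventually.of_forall fun x => ?_)) hu
  have : (i '' A).indicator (1 : K → ℝ) (i x) = A.indicator 1 x := by
    by_cases hx : x ∈ A
    · simp [hx, mem_image_of_mem i hx]
    · have : i x ∉ i '' A := by rwa [hi.injective.mem_set_image]
      simp [hx, this]
  simp only [this, Real.norm_eq_abs]

lemma measurable_indicator_one {A : Set X} (hA : MeasurableSet A) :
    Measurable (A.indicator (1 : X → ℝ)) := measurable_one.indicator hA

omit [MeasurableSpace X] in
lemma abs_indicator_one_le (A : Set X) (x : X) : |A.indicator (1 : X → ℝ) x| ≤ 1 := by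
  by_cases hx : x ∈ A <;> simp [hx]

omit [MeasurableSpace X] [MeasurableSpace Y] in
lemma abs_indicator_mul_sub_le (A : Set X) (B : Set Y) (x : X) (y : Y) {a b C : ℝ}
    (ha : |a| ≤ C) :
    |A.indicator 1 x * B.indicator 1 y - a * b|
      ≤ |A.indicator 1 x - a| + C * |B.indicator 1 y - b| := by
  have h : A.indicator 1 x * B.indicator 1 y - a * b
      = (A.indicator 1 x - a) * B.indicator 1 y + a * (B.indicator 1 y - b) := by ring
  rw [h]
  refine (abs_add_le _ _).trans ?_
  rw [abs_mul, abs_mul]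
  gcongr
  exact mul_le_of_le_one_right (abs_nonneg _) (abs_indicator_one_le B y)

/-- A dual-dominating functional is given on measurable rectangles by a coupling. -/
lemma DominatesDual.exists_coupling [StandardBorelSpace X] [StandardBorelSpace Y]
    (hL : DominatesDual m n f g L) :
    ∃ π : Measure (X × Y), π.fst = m ∧ π.snd = n ∧
      ∀ A B, MeasurableSet A → MeasurableSet B →
        L (fun p => A.indicator 1 p.1 * B.indicator 1 p.2)
          = ∫ p, A.indicator 1 p.1 * B.indicator 1 p.2 ∂π := by
  obtain ⟨i, hi⟩ := exists_measurableEmbedding_cantor X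
  obtain ⟨j, hj⟩ := exists_measurableEmbedding_cantor Y
  obtain ⟨ρ, hρ, hρL⟩ := hL.exists_measure_integral_eq i j
  have hfst : ρ.fst = m.map i := by
    refine ext_of_forall_integral_eq_of_IsFiniteMeasure fun u => ?_
    obtain ⟨C, hC⟩ : ∃ C, ∀ k, |u k| ≤ C := ⟨‖u‖, fun k => u.norm_coe_le_norm k⟩
    rw [hi.integral_map, Measure.fst, integral_map measurable_fst.aemeasurable
      u.continuous.aestronglyMeasurable, hρL (fun q => u q.1) (by fun_prop)]
    have := hL.map_sum (φ := fun x => u (i x)) (ψ := 0)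
      (u.continuous.measurable.comp hi.measurable) ⟨C, fun x => hC _⟩ measurable_zero ⟨0, by simp⟩
    simpa using this
  have hsnd : ρ.snd = n.map j := by
    refine ext_of_forall_integral_eq_of_IsFiniteMeasure fun u => ?_
    obtain ⟨C, hC⟩ : ∃ C, ∀ k, |u k| ≤ C := ⟨‖u‖, fun k => u.norm_coe_le_norm k⟩
    rw [hj.integral_map, Measure.snd, integral_map measurable_snd.aemeasurable
      u.continuous.aestronglyMeasurable, hρL (fun q => u q.2) (by fun_prop)]
    have := hL.map_sum (ψ := fun y => u (j y)) (φ := 0) measurable_zero ⟨0, by simp⟩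
      (u.continuous.measurable.comp hj.measurable) ⟨C, fun x => hC _⟩
    simpa using this
  have hij : MeasurableEmbedding (Prod.map i j) := hi.prodMap hj
  have hrange : ∀ᵐ p ∂ρ, p ∈ range (Prod.map i j) := by
    have h1 : ∀ᵐ p ∂ρ, p.1 ∈ range i := by
      refine ae_of_ae_map measurable_fst.aemeasurable (p := fun k => k ∈ range i) ?_
      change ∀ᵐ k ∂ρ.fst, k ∈ range i
      rw [hfst, hi.ae_map_iff]
      simp
    have h2 : ∀ᵐ p ∂ρ, p.2 ∈ range j := by
      refine ae_of_ae_map measurable_snd.aemeasurable (p := fun k => k ∈ range j) ?_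
      change ∀ᵐ k ∂ρ.snd, k ∈ range j
      rw [hsnd, hj.ae_map_iff]
      simp
    filter_upwards [h1, h2] with p hp1 hp2
    rw [range_prodMap]
    exact ⟨hp1, hp2⟩
  let π : Measure (X × Y) := ρ.comap (Prod.map i j)
  have hπ : π.map (Prod.map i j) = ρ := by
    rw [hij.map_comap, Measure.restrict_eq_self_of_ae_mem hrange]
  have hπ1 : π.fst = m := by
    have : π.fst.map i = m.map i := by
      rw [← hfst, ← hπ, Measure.fst, Measure.fst, Measure.map_map hi.measurable measurable_fst,
        Measure.map_map measurable_fst hij.measurable]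
      rfl
    rw [← hi.comap_map π.fst, this, hi.comap_map]
  have hπ2 : π.snd = n := by
    have : π.snd.map j = n.map j := by
      rw [← hsnd, ← hπ, Measure.snd, Measure.snd, Measure.map_map hj.measurable measurable_snd,
        Measure.map_map measurable_snd hij.measurable]
      rfl
    rw [← hj.comap_map π.snd, this, hj.comap_map]
  have hπprob : IsProbabilityMeasure π := ⟨by rw [← Measure.fst_univ, hπ1, measure_univ]⟩
  refine ⟨π, hπ1, hπ2, fun A B hA hB => ?_⟩
  refine eq_of_abs_sub_le_all fun ε hε => ?_
  obtain ⟨u, hu, ⟨C, hC0, hC⟩, huA⟩ :=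
    exists_continuous_integral_abs_sub_le (m := m) hi hA (ε := ε / 4) (by positivity)
  obtain ⟨v, hv, ⟨D, hD0, hD⟩, hvB⟩ :=
    exists_continuous_integral_abs_sub_le (m := n) hj hB (ε := ε / 4 / (C + 1)) (by positivity)
  set h : X × Y → ℝ := fun p => A.indicator 1 p.1 * B.indicator 1 p.2 with hh
  set w : X × Y → ℝ := fun p => u (i p.1) * v (j p.2) with hw
  set α : X → ℝ := fun x => |A.indicator 1 x - u (i x)| with hα
  set β : Y → ℝ := fun y => C * |B.indicator 1 y - v (j y)| with hβ
  have hα_m : Measurable α :=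
    ((measurable_indicator_one hA).sub (hu.measurable.comp hi.measurable)).abs
  have hβ_m : Measurable β :=
    (((measurable_indicator_one hB).sub (hv.measurable.comp hj.measurable)).abs).const_mul C
  have hα_b : ∀ x, |α x| ≤ 1 + C := fun x => by
    rw [hα, abs_abs]
    exact (abs_sub _ _).trans (add_le_add (abs_indicator_one_le A x) (hC _))
  have hβ_b : ∀ y, |β y| ≤ C * (1 + D) := fun y => by
    rw [hβ, abs_mul, abs_abs, abs_of_nonneg hC0]
    gcongr
    exact (abs_sub _ _).trans (add_le_add (abs_indicator_one_le B y) (hD _))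
  have hαβ : ∫ x, α x ∂m + ∫ y, β y ∂n ≤ ε / 2 := by
    have h1 : ∫ y, β y ∂n ≤ C * (ε / 4 / (C + 1)) := by
      rw [hβ, integral_const_mul]
      gcongr
    have h2 : C * (ε / 4 / (C + 1)) ≤ ε / 4 := by
      rw [mul_div_assoc', div_le_iff₀ (by positivity)]
      nlinarith
    linarith
  have hle : ∀ p, |(h - w) p| ≤ α p.1 + β p.2 := fun p =>
    abs_indicator_mul_sub_le A B p.1 p.2 (hC _)
  have hLw : L w = ∫ p, w p ∂π := by
    rw [← hρL (fun q => u q.1 * v q.2) (by fun_prop), ← hπ, hij.integral_map]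
    rfl
  have h1 := hL.abs_le hα_m ⟨_, hα_b⟩ hβ_m ⟨_, hβ_b⟩ hle
  have hhi : Integrable h π :=
    Measurable.integrable_of_abs_le (C := 1)
      (((measurable_indicator_one hA).comp measurable_fst).mul
        ((measurable_indicator_one hB).comp measurable_snd)) fun p => by
      rw [hh, abs_mul]
      exact mul_le_one₀ (abs_indicator_one_le A _) (abs_nonneg _) (abs_indicator_one_le B _)
  have hwi : Integrable w π :=
    Measurable.integrable_of_abs_le (C := C * D)
      (((hu.measurable.comp hi.measurable).comp measurable_fst).mul
        ((hv.measurable.comp hj.measurable).comp measurable_snd)) fun p => by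
      rw [hw, abs_mul]
      exact mul_le_mul (hC _) (hD _) (abs_nonneg _) hC0
  have hcoup : IsFiberCoupling m n (fun _ => ()) (fun _ => ()) π := ⟨hπ1, hπ2, by simp⟩
  obtain ⟨iα, eα⟩ := hcoup.integral_fst (hα_m.integrable_of_abs_le hα_b)
  obtain ⟨iβ, eβ⟩ := hcoup.integral_snd (hβ_m.integrable_of_abs_le hβ_b)
  have h2 : |∫ p, (h - w) p ∂π| ≤ ∫ x, α x ∂m + ∫ y, β y ∂n := by
    rw [← eα, ← eβ, ← integral_add iα iβ]
    exact abs_integral_le_integral_abs.trans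
      (integral_mono (hhi.sub hwi).abs (iα.add iβ) hle)
  rw [map_sub] at h1
  rw [integral_sub' hhi hwi, ← hLw] at h2
  have h3 : L h - ∫ p, h p ∂π = (L h - L w) - (∫ p, h p ∂π - L w) := by ring
  rw [h3]
  refine (abs_sub _ _).trans ?_
  linarith

end Representation


section PrimalAttainment

variable {X Y Z : Type*} [MeasurableSpace X] [MeasurableSpace Y]
  {m : Measure X} {n : Measure Y} {f : X → Z} {g : Y → Z}
  [IsProbabilityMeasure m] [IsProbabilityMeasure n] {L : (X × Y → ℝ) →ₗ[ℝ] ℝ}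

omit [IsProbabilityMeasure m] [IsProbabilityMeasure n] in
/-- A measure representing a dual-dominating functional on rectangles is concentrated on the fibre
product. -/
lemma DominatesDual.ae_eq_of_rectangles [MeasurableSpace Z] [MeasurableSpace.CountablySeparated Z]
    (hL : DominatesDual m n f g L) (hf : Measurable f) (hg : Measurable g)
    {π : Measure (X × Y)} [IsFiniteMeasure π]
    (hπ : ∀ A B, MeasurableSet A → MeasurableSet B →
        L (fun p => A.indicator 1 p.1 * B.indicator 1 p.2)
          = ∫ p, A.indicator 1 p.1 * B.indicator 1 p.2 ∂π) :
    ∀ᵐ p ∂π, f p.1 = g p.2 := by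
  have key : ∀ U V : Set Z, MeasurableSet U → MeasurableSet V → Disjoint U V →
      ∀ᵐ p ∂π, f p.1 ∈ U → g p.2 ∉ V := by
    intro U V hU hV hUV
    have hU' := hf hU
    have hV' := hg hV
    have hbd : ∀ p : X × Y, |(f ⁻¹' U).indicator (1 : X → ℝ) p.1
        * (g ⁻¹' V).indicator (1 : Y → ℝ) p.2| ≤ 1 := fun p => by
      rw [abs_mul]
      exact mul_le_one₀ (abs_indicator_one_le _ _) (abs_nonneg _) (abs_indicator_one_le _ _)
    have h0 := hL.nonneg_of_fiber
      (h := -fun p => (f ⁻¹' U).indicator 1 p.1 * (g ⁻¹' V).indicator 1 p.2)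
      ⟨1, fun p => by simpa only [Pi.neg_apply, abs_neg] using hbd p⟩ (by
        intro x y hxy
        by_cases hx : f x ∈ U
        · have : g y ∉ V := fun hy => Set.disjoint_left.1 hUV (hxy ▸ hx) hy
          simp [this]
        · simp [hx])
    rw [map_neg, hπ _ _ hU' hV', Left.nonneg_neg_iff] at h0
    have hnn : ∀ p : X × Y, 0 ≤ (f ⁻¹' U).indicator (1 : X → ℝ) p.1
        * (g ⁻¹' V).indicator (1 : Y → ℝ) p.2 := fun p =>
      mul_nonneg (indicator_nonneg (by simp) _) (indicator_nonneg (by simp) _)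
    have hint := (((measurable_indicator_one hU').comp measurable_fst).mul
        ((measurable_indicator_one hV').comp measurable_snd)).integrable_of_abs_le (μ := π) hbd
    have h1 := (integral_eq_zero_iff_of_nonneg hnn hint).1
      (le_antisymm h0 (integral_nonneg hnn))
    filter_upwards [h1] with p hp hpU hpV
    simp [hpU, hpV] at hp
  refine Filter.EventuallyEq.of_forall_separating_mem_iff MeasurableSet
    (f := fun p : X × Y => f p.1) (g := fun p : X × Y => g p.2) fun U hU => ?_
  filter_upwards [key U Uᶜ hU hU.compl disjoint_compl_right,
    key Uᶜ U hU.compl hU disjoint_compl_left] with p h1 h2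
  simp only [mem_compl_iff, not_not] at h1 h2
  exact ⟨h1, fun h => by_contra fun h' => h2 h' h⟩

lemma map_comp_simpleFunc {π : Measure (X × Y)} [IsFiniteMeasure π]
    (hπ : ∀ A B, MeasurableSet A → MeasurableSet B →
        L (fun p => A.indicator 1 p.1 * B.indicator 1 p.2)
          = ∫ p, A.indicator 1 p.1 * B.indicator 1 p.2 ∂π)
    {X' Y' : Type*} (P : SimpleFunc X X') (Q : SimpleFunc Y Y') (c : X' × Y' → ℝ) :
    L (fun p => c (P p.1, Q p.2)) = ∫ p, c (P p.1, Q p.2) ∂π := by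
  classical
  have hsum : (fun p : X × Y => c (P p.1, Q p.2)) = ∑ a ∈ P.range, ∑ b ∈ Q.range,
      c (a, b) • fun p : X × Y => (P ⁻¹' {a}).indicator 1 p.1 * (Q ⁻¹' {b}).indicator 1 p.2 := by
    funext p
    simp only [Finset.sum_apply, Pi.smul_apply, smul_eq_mul]
    rw [Finset.sum_eq_single (P p.1), Finset.sum_eq_single (Q p.2)]
    · simp
    · intro b _ hb
      simp [hb.symm]
    · simp
    · intro a _ ha
      simp [ha.symm]
    · simp
  have hint : ∀ a b, Integrable (fun p : X × Y => (P ⁻¹' {a}).indicator (1 : X → ℝ) p.1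
      * (Q ⁻¹' {b}).indicator (1 : Y → ℝ) p.2) π := fun a b =>
    (((measurable_indicator_one (P.measurableSet_fiber a)).comp measurable_fst).mul
      ((measurable_indicator_one (Q.measurableSet_fiber b)).comp
        measurable_snd)).integrable_of_abs_le (C := 1) fun p => by
      rw [Pi.mul_apply, abs_mul]
      exact mul_le_one₀ (abs_indicator_one_le _ _) (abs_nonneg _) (abs_indicator_one_le _ _)
  have hsum' : ∫ p, c (P p.1, Q p.2) ∂π = ∫ p : X × Y, ∑ a ∈ P.range, ∑ b ∈ Q.range,
      c (a, b) • ((P ⁻¹' {a}).indicator 1 p.1 * (Q ⁻¹' {b}).indicator 1 p.2) ∂π :=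
    integral_congr_ae (Eventually.of_forall fun p => by
      simpa only [Finset.sum_apply, Pi.smul_apply] using congrFun hsum p)
  have hint' : ∀ a b, Integrable (fun p : X × Y => c (a, b) • ((P ⁻¹' {a}).indicator (1 : X → ℝ) p.1
      * (Q ⁻¹' {b}).indicator (1 : Y → ℝ) p.2)) π := fun a b => (hint a b).const_mul _
  rw [hsum', hsum]
  simp only [map_sum, map_smul]
  rw [integral_finsetSum _ fun a _ => integrable_finsetSum _ fun b _ => hint' a b]
  refine Finset.sum_congr rfl fun a _ => ?_
  rw [integral_finsetSum _ fun b _ => hint' a b]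
  refine Finset.sum_congr rfl fun b _ => ?_
  rw [hπ _ _ (P.measurableSet_fiber a) (Q.measurableSet_fiber b), integral_smul]

/-- Simple functions approximate the identity of a separable metric space in measure. -/
lemma exists_simpleFunc_tendsto (X : Type*) [MeasurableSpace X] [MetricSpace X]
    [OpensMeasurableSpace X] [TopologicalSpace.SeparableSpace X] [Nonempty X] :
    ∃ P : ℕ → SimpleFunc X X, (∀ x, Tendsto (fun N => P N x) atTop (𝓝 x)) ∧
      ∀ (m : Measure X) [IsFiniteMeasure m] (δ : ℝ), 0 < δ →
        Tendsto (fun N => m.real {x | δ ≤ dist (P N x) x}) atTop (𝓝 0) := by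
  have hP : ∀ x : X, Tendsto (fun N => SimpleFunc.nearestPt (TopologicalSpace.denseSeq X) N x)
      atTop (𝓝 x) := fun x =>
    SimpleFunc.tendsto_nearestPt (by simp [(TopologicalSpace.denseRange_denseSeq X).closure_range])
  refine ⟨_, hP, fun m _ δ hδ => ?_⟩
  have h := tendstoInMeasure_of_tendsto_ae (μ := m)
    (f := fun N => SimpleFunc.nearestPt (TopologicalSpace.denseSeq X) N) (g := id)
    (fun N => (SimpleFunc.stronglyMeasurable _).aestronglyMeasurable)
    (Eventually.of_forall fun x => hP x)
  rw [tendstoInMeasure_iff_dist] at h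
  have := (ENNReal.tendsto_toReal zero_ne_top).comp (h δ hδ)
  simpa [Function.comp_def, Measure.real] using this

lemma const_mul_indicator_one_nonneg {Ω : Type*} {C : ℝ} (hC : 0 ≤ C) (A : Set Ω) (x : Ω) :
    0 ≤ C * A.indicator (1 : Ω → ℝ) x :=
  mul_nonneg hC (indicator_nonneg (by simp) _)

lemma abs_const_mul_indicator_one_le {Ω : Type*} {C : ℝ} (hC : 0 ≤ C) (A : Set Ω) (x : Ω) :
    |C * A.indicator (1 : Ω → ℝ) x| ≤ C := by
  rw [abs_mul, abs_of_nonneg hC]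
  exact mul_le_of_le_one_right hC (abs_indicator_one_le A x)

/-- A dual-dominating functional integrates bounded uniformly continuous functions against any
measure which represents it on rectangles. -/
lemma DominatesDual.map_eq_integral_of_uniformContinuous
    {X Y : Type*} [MeasurableSpace X] [MetricSpace X] [BorelSpace X]
    [SecondCountableTopology X]
    [MeasurableSpace Y] [MetricSpace Y] [BorelSpace Y] [SecondCountableTopology Y]
    {m : Measure X} {n : Measure Y} {f : X → Z} {g : Y → Z}
    [IsProbabilityMeasure m] [IsProbabilityMeasure n] {L : (X × Y → ℝ) →ₗ[ℝ] ℝ}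
    (hL : DominatesDual m n f g L)
    {π : Measure (X × Y)} [IsFiniteMeasure π]
    (hπ : ∀ A B, MeasurableSet A → MeasurableSet B →
        L (fun p => A.indicator 1 p.1 * B.indicator 1 p.2)
          = ∫ p, A.indicator 1 p.1 * B.indicator 1 p.2 ∂π)
    {c : X × Y → ℝ} (hc : UniformContinuous c) {M : ℝ} (hM : ∀ p, |c p| ≤ M) :
    L c = ∫ p, c p ∂π := by
  have : Nonempty X := m.nonempty_of_neZero
  have : Nonempty Y := n.nonempty_of_neZero
  obtain ⟨P, hP, hPm⟩ := exists_simpleFunc_tendsto X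
  obtain ⟨Q, hQ, hQm⟩ := exists_simpleFunc_tendsto Y
  have hM0 : 0 ≤ M := (abs_nonneg _).trans (hM (Classical.arbitrary _))
  have h1 : Tendsto (fun N => L fun p => c (P N p.1, Q N p.2)) atTop (𝓝 (∫ p, c p ∂π)) := by
    simp_rw [map_comp_simpleFunc hπ]
    refine tendsto_integral_of_dominated_convergence (fun _ => M) (fun N => ?_)
      (integrable_const _) (fun N => Eventually.of_forall fun p => hM _)
      (Eventually.of_forall fun p => ?_)
    · exact (hc.continuous.measurable.comp (((P N).measurable.comp measurable_fst).prodMk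
        ((Q N).measurable.comp measurable_snd))).aestronglyMeasurable
    · exact (hc.continuous.tendsto p).comp ((hP p.1).prodMk_nhds (hQ p.2))
  refine tendsto_nhds_unique (Metric.tendsto_atTop'.2 fun ε hε => ?_) h1
  obtain ⟨δ, hδ, hcδ⟩ := Metric.uniformContinuous_iff.1 hc (ε / 2) (half_pos hε)
  have h2 : Tendsto (fun N => ε / 2 + (2 * M * m.real {x | δ ≤ dist (P N x) x}
      + 2 * M * n.real {y | δ ≤ dist (Q N y) y})) atTop (𝓝 (ε / 2 + (2 * M * 0 + 2 * M * 0))) :=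
    tendsto_const_nhds.add (((hPm m δ hδ).const_mul _).add ((hQm n δ hδ).const_mul _))
  obtain ⟨N₀, hN₀⟩ := eventually_atTop.1 (h2.eventually_lt_const (u := ε) (by linarith))
  refine ⟨N₀, fun N hN => lt_of_le_of_lt ?_ (hN₀ N hN.le)⟩
  have hA : MeasurableSet {x | δ ≤ dist (P N x) x} :=
    measurableSet_le measurable_const ((P N).measurable.dist measurable_id)
  have hB : MeasurableSet {y | δ ≤ dist (Q N y) y} :=
    measurableSet_le measurable_const ((Q N).measurable.dist measurable_id)
  have hM2 : 0 ≤ 2 * M := by positivity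
  rw [Real.dist_eq, ← map_sub]
  refine (hL.abs_le
    (φ := fun x => ε / 2 + 2 * M * {x | δ ≤ dist (P N x) x}.indicator 1 x)
    (ψ := fun y => 2 * M * {y | δ ≤ dist (Q N y) y}.indicator 1 y)
    (((measurable_indicator_one hA).const_mul _).const_add _)
    ⟨ε / 2 + 2 * M, fun x => (abs_add_le _ _).trans
      (add_le_add (abs_of_pos (half_pos hε)).le (abs_const_mul_indicator_one_le hM2 _ x))⟩
    ((measurable_indicator_one hB).const_mul _) ⟨2 * M, abs_const_mul_indicator_one_le hM2 _⟩
    fun p => ?_).trans (le_of_eq ?_)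
  · have htriv : |((fun p : X × Y => c (P N p.1, Q N p.2)) - c) p| ≤ 2 * M := by
      refine (abs_sub _ _).trans ?_
      linarith [hM (P N p.1, Q N p.2), hM p]
    by_cases hx : δ ≤ dist (P N p.1) p.1
    · have := const_mul_indicator_one_nonneg hM2 {y | δ ≤ dist (Q N y) y} p.2
      simp only [mem_ofPred_eq, hx, indicator_of_mem, Pi.one_apply]
      linarith
    by_cases hy : δ ≤ dist (Q N p.2) p.2
    · have := const_mul_indicator_one_nonneg hM2 {x | δ ≤ dist (P N x) x} p.1
      simp only [mem_ofPred_eq, hy, indicator_of_mem, Pi.one_apply]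
      linarith
    have := @hcδ (P N p.1, Q N p.2) p (by
      rw [Prod.dist_eq]
      exact max_lt (not_le.1 hx) (not_le.1 hy))
    rw [Real.dist_eq] at this
    simp only [mem_ofPred_eq, hx, hy, not_false_eq_true, indicator_of_notMem, mul_zero, add_zero]
    exact this.le
  · rw [integral_add (integrable_const _)
      (((measurable_indicator_one hA).const_mul _).integrable_of_abs_le
        (abs_const_mul_indicator_one_le hM2 _)),
      integral_const_mul, integral_const_mul, integral_indicator_one hA, integral_indicator_one hB]
    simp [add_assoc]

end PrimalAttainment

section DualAttainment

lemma exists_fiberMean {X Z : Type*} [MeasurableSpace X] [StandardBorelSpace X] [MeasurableSpace Z]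
    [MeasurableEq Z] {m : Measure X} [IsProbabilityMeasure m] {f : X → Z} (hf : Measurable f)
    {φ : X → ℝ} (hφ : Integrable φ m) :
    ∃ a : Z → ℝ, Integrable a (m.map f) ∧
      (∀ S, MeasurableSet S → ∫ x in f ⁻¹' S, φ x ∂m = ∫ z in S, a z ∂(m.map f)) ∧
      ∀ᵐ z ∂(m.map f), ∀ t, (∀ x, f x = z → φ x ≤ t) → a z ≤ t := by
  have : Nonempty X := m.nonempty_of_neZero
  have hK : (m.map f) ⊗ₘ condDistrib id f m = m.map (fun x => (f x, x)) :=
    compProd_map_condDistrib aemeasurable_id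
  have hmeas : Measurable fun x => (f x, x) := hf.prodMk measurable_id
  have hint : Integrable (fun p : Z × X => φ p.2) ((m.map f) ⊗ₘ condDistrib id f m) := by
    rw [hK, integrable_map_measure _ hmeas.aemeasurable]
    · exact hφ
    · have h1 : (m.map fun x => (f x, x)).map Prod.snd = m := by
        rw [Measure.map_map measurable_snd hmeas]
        exact Measure.map_id
      exact AEStronglyMeasurable.comp_measurable (h1.symm ▸ hφ.aestronglyMeasurable) measurable_snd
  refine ⟨fun z => ∫ x, φ x ∂(condDistrib id f m z), hint.integral_compProd, fun S hS => ?_, ?_⟩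
  · have h := Measure.setIntegral_compProd hS MeasurableSet.univ hint.integrableOn
    simp only [Measure.restrict_univ] at h
    rw [← h, hK, setIntegral_map (hS.prod MeasurableSet.univ) _ hmeas.aemeasurable]
    · simp [mk_preimage_prod]
    · rw [← hK]
      exact hint.aestronglyMeasurable
  · have h1 : ∀ᵐ p ∂((m.map f) ⊗ₘ condDistrib id f m), f p.2 = p.1 := by
      have hs : MeasurableSet {p : Z × X | f p.2 = p.1} :=
        measurableSet_eq_fun (hf.comp measurable_snd) measurable_fst
      rw [hK, ae_map_iff hmeas.aemeasurable hs]
      exact Eventually.of_forall fun x => rfl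
    filter_upwards [Measure.ae_ae_of_ae_compProd h1,
      ((Measure.integrable_compProd_iff hint.aestronglyMeasurable).1 hint).1] with z hz hz' t ht
    calc ∫ x, φ x ∂(condDistrib id f m z) ≤ ∫ _, t ∂(condDistrib id f m z) :=
          integral_mono_ae hz' (integrable_const t) (hz.mono fun x hx => ht x hx)
      _ = t := by simp

variable {X Y Z : Type*} [MeasurableSpace X] [MeasurableSpace Y] [StandardBorelSpace X]
  [StandardBorelSpace Y] [MeasurableSpace Z] [MeasurableEq Z]
  {m : Measure X} {n : Measure Y} {f : X → Z} {g : Y → Z}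
  [IsProbabilityMeasure m] [IsProbabilityMeasure n] {c : X × Y → ℝ} {M : ℝ}

/-- Potentials can be replaced by potentials which are bounded by the supremum of the cost. -/
lemma IsPotentialPair.exists_bounded {φ : X → ℝ} {ψ : Y → ℝ}
    (h : IsPotentialPair m n f g c φ ψ) (hf : Measurable f) (hg : Measurable g)
    (hfg : m.map f = n.map g) (hc0 : ∀ p, 0 ≤ c p) (hcM : ∀ p, c p ≤ M) :
    ∃ φ' ψ', IsPotentialPair m n f g c φ' ψ' ∧ (∀ x, |φ' x| ≤ M) ∧ (∀ y, |ψ' y| ≤ M) ∧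
      ∫ x, φ x ∂m + ∫ y, ψ y ∂n ≤ ∫ x, φ' x ∂m + ∫ y, ψ' y ∂n := by
  obtain ⟨a, ha, haS, hat⟩ := exists_fiberMean hf h.fst
  obtain ⟨b, hb, hbS, hbt⟩ := exists_fiberMean hg h.snd
  rw [← hfg] at hb hbS hbt
  set τ := m.map f with hτ
  have hM : 0 ≤ M := by
    obtain ⟨x⟩ := m.nonempty_of_neZero
    obtain ⟨y⟩ := n.nonempty_of_neZero
    exact (hc0 (x, y)).trans (hcM _)
  let T : Set Z := {z | (∀ t, (∀ x, f x = z → φ x ≤ t) → a z ≤ t) ∧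
    (∀ t, (∀ y, g y = z → ψ y ≤ t) → b z ≤ t) ∧ 0 ≤ a z + b z}
  have hTae : T =ᵐ[τ] {z | 0 ≤ a z + b z} := by
    filter_upwards [hat, hbt] with z h1 h2
    exact propext ⟨fun h => h.2.2, fun h => ⟨h1, h2, h⟩⟩
  have hT : NullMeasurableSet T τ :=
    (nullMeasurableSet_le aemeasurable_const (ha.add hb).aemeasurable).congr hTae.symm
  obtain ⟨S, hST, hS, hSae⟩ := hT.exists_measurable_subset_ae_eq
  have hfS := hf hS
  have hgS := hg hS
  have haf : Integrable (fun x => a (f x)) m := ha.comp_measurable hf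
  have hag : Integrable (fun y => a (g y)) n :=
    (hfg ▸ ha : Integrable a (n.map g)).comp_measurable hg
  have iφ : Integrable ((f ⁻¹' S).indicator fun x => φ x - a (f x)) m :=
    (h.fst.sub haf).indicator hfS
  have iψ : Integrable ((g ⁻¹' S).indicator fun y => ψ y + a (g y)) n :=
    (h.snd.add hag).indicator hgS
  have eφ : ∫ x, (f ⁻¹' S).indicator (fun x => φ x - a (f x)) x ∂m = 0 := by
    rw [integral_indicator hfS, integral_sub h.fst.integrableOn haf.integrableOn, haS S hS,
      setIntegral_map hS ha.aestronglyMeasurable hf.aemeasurable, sub_self]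
  have eψ : ∫ y, (g ⁻¹' S).indicator (fun y => ψ y + a (g y)) y ∂n
      = ∫ z in S, (a z + b z) ∂τ := by
    rw [integral_indicator hgS, integral_add h.snd.integrableOn hag.integrableOn, hbS S hS,
      integral_add ha.integrableOn hb.integrableOn, add_comm]
    congr 1
    rw [hfg, setIntegral_map hS (hfg ▸ ha.aestronglyMeasurable) hg.aemeasurable]
  have hval : ∫ x, φ x ∂m + ∫ y, ψ y ∂n ≤ ∫ z in S, (a z + b z) ∂τ := by
    have e1 := haS univ MeasurableSet.univ
    have e2 := hbS univ MeasurableSet.univ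
    simp only [preimage_univ, Measure.restrict_univ] at e1 e2
    rw [e1, e2, ← integral_add ha hb, ← integral_indicator hS]
    refine integral_mono_ae (ha.add hb) ((ha.add hb).indicator hS) ?_
    filter_upwards [hSae.trans hTae] with z hz
    have hz' : z ∈ S ↔ 0 ≤ a z + b z := iff_of_eq hz
    by_cases hzS : z ∈ S
    · simp [hzS]
    · simp only [hzS, not_false_eq_true, indicator_of_notMem]
      exact (not_le.1 fun h => hzS (hz'.2 h)).le
  have bφ : ∀ x, (f ⁻¹' S).indicator (fun x => φ x - a (f x)) x ≤ M := fun x => by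
    by_cases hx : f x ∈ S
    · have h1 := (hST hx).2.1 (M - φ x) fun y hy => by
        linarith [h.le x y hy.symm, hcM (x, y)]
      have h2 := (hST hx).2.2
      simp only [mem_preimage, hx, indicator_of_mem]
      linarith
    · simpa [hx] using hM
  have bψ : ∀ y, (g ⁻¹' S).indicator (fun y => ψ y + a (g y)) y ≤ M := fun y => by
    by_cases hy : g y ∈ S
    · have h1 := (hST hy).1 (M - ψ y) fun x hx => by
        linarith [h.le x y hx, hcM (x, y)]
      simp only [mem_preimage, hy, indicator_of_mem]
      linarith
    · simpa [hy] using hM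
  have hsum : ∀ x y, f x = g y → (f ⁻¹' S).indicator (fun x => φ x - a (f x)) x
      + (g ⁻¹' S).indicator (fun y => ψ y + a (g y)) y ≤ c (x, y) := fun x y hxy => by
    by_cases hy : g y ∈ S
    · have h1 := h.le x y hxy
      simp only [mem_preimage, hy, hxy, indicator_of_mem]
      linarith
    · simpa [hy, hxy] using hc0 (x, y)
  generalize (f ⁻¹' S).indicator (fun x => φ x - a (f x)) = φ' at *
  generalize (g ⁻¹' S).indicator (fun y => ψ y + a (g y)) = ψ' at *
  have iφ' : Integrable (fun x => max (φ' x) (-M)) m := iφ.sup (integrable_const _)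
  have iψ' : Integrable (fun y => max (ψ' y) (-M)) n := iψ.sup (integrable_const _)
  refine ⟨_, _, ⟨iφ', iψ', fun x y hxy => ?_⟩, fun x => ?_, fun y => ?_, ?_⟩
  · have h1 := hsum x y hxy
    have h2 := bφ x
    have h3 := bψ y
    have h4 := hc0 (x, y)
    rcases max_cases (φ' x) (-M) with h | h <;> rcases max_cases (ψ' y) (-M) with h' | h' <;>
      linarith
  · exact abs_le.2 ⟨le_max_right _ _, max_le (bφ x) (by linarith)⟩
  · exact abs_le.2 ⟨le_max_right _ _, max_le (bψ y) (by linarith)⟩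
  · have h1 := integral_mono iφ iφ' fun x => le_max_left _ _
    have h2 := integral_mono iψ iψ' fun y => le_max_left _ _
    linarith

end DualAttainment

/-- Nested bounded nonempty closed convex subsets of a Hilbert space have a common point. -/
lemma Antitone.nonempty_iInter_of_convex {H : Type*} [NormedAddCommGroup H] [InnerProductSpace ℝ H]
    [CompleteSpace H] {K : ℕ → Set H} (hK : Antitone K) (hne : ∀ k, (K k).Nonempty)
    (hclosed : ∀ k, IsClosed (K k)) (hconv : ∀ k, Convex ℝ (K k))
    {R : ℝ} (hR : ∀ u ∈ K 0, ‖u‖ ≤ R) : (⋂ k, K k).Nonempty := by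
  choose v hvK hv using fun k =>
    exists_norm_eq_iInf_of_complete_convex (hne k) (hclosed k).isComplete (hconv k) 0
  have key : ∀ k l, k ≤ l → ‖v k - v l‖ ^ 2 ≤ ‖v l‖ ^ 2 - ‖v k‖ ^ 2 := fun k l hkl => by
    have h := (norm_eq_iInf_iff_real_inner_le_zero (hconv k) (hvK k)).1 (hv k) (v l)
      (hK hkl (hvK l))
    rw [zero_sub, inner_neg_left, inner_sub_right, real_inner_self_eq_norm_sq] at h
    rw [norm_sub_sq_real]
    linarith
  have hmono : Monotone fun k => ‖v k‖ ^ 2 := fun k l hkl => by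
    have := (sq_nonneg _).trans (key k l hkl)
    simpa using this
  have hbdd : BddAbove (range fun k => ‖v k‖ ^ 2) := ⟨R ^ 2, by
    rintro _ ⟨k, rfl⟩
    exact pow_le_pow_left₀ (norm_nonneg _) (hR _ (hK (Nat.zero_le k) (hvK k))) 2⟩
  have hlim := tendsto_atTop_ciSup hmono hbdd
  have hc : CauchySeq v := by
    refine cauchySeq_of_le_tendsto_0' (fun k => √((⨆ k, ‖v k‖ ^ 2) - ‖v k‖ ^ 2))
      (fun k l hkl => ?_) ?_
    · rw [dist_eq_norm]
      refine Real.le_sqrt_of_sq_le ((key k l hkl).trans ?_)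
      have := le_ciSup hbdd l
      linarith
    · have := (hlim.const_sub (⨆ k, ‖v k‖ ^ 2)).sqrt
      simpa using this
  obtain ⟨w, hw⟩ := cauchySeq_tendsto_of_complete hc
  refine ⟨w, mem_iInter.2 fun k => (hclosed k).mem_of_tendsto hw ?_⟩
  filter_upwards [eventually_ge_atTop k] with l hl
  exact hK hl (hvK l)

section Maximizer

variable {X Y Z : Type*} [MeasurableSpace X] [MeasurableSpace Y]
  {m : Measure X} {n : Measure Y} {f : X → Z} {g : Y → Z} {c : X × Y → ℝ} {M s : ℝ}

/-- Potentials bounded by `M` with dual value at least `s`. -/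
structure IsNearOptimalPair (m : Measure X) (n : Measure Y) (f : X → Z) (g : Y → Z)
    (c : X × Y → ℝ) (M s : ℝ) (φ : X → ℝ) (ψ : Y → ℝ) : Prop
    extends IsPotentialPair m n f g c φ ψ where
  abs_fst_le : ∀ x, |φ x| ≤ M
  abs_snd_le : ∀ y, |ψ y| ≤ M
  le_value : s ≤ ∫ x, φ x ∂m + ∫ y, ψ y ∂n

lemma IsNearOptimalPair.convexComb {φ φ' : X → ℝ} {ψ ψ' : Y → ℝ}
    (h : IsNearOptimalPair m n f g c M s φ ψ) (h' : IsNearOptimalPair m n f g c M s φ' ψ')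
    {a b : ℝ} (ha : 0 ≤ a) (hb : 0 ≤ b) (hab : a + b = 1) :
    IsNearOptimalPair m n f g c M s (fun x => a * φ x + b * φ' x)
      (fun y => a * ψ y + b * ψ' y) := by
  have hcomb : ∀ {p q r : ℝ}, p ≤ r → q ≤ r → a * p + b * q ≤ r := fun {p q r} hp hq => by
    calc a * p + b * q ≤ a * r + b * r :=
          add_le_add (mul_le_mul_of_nonneg_left hp ha) (mul_le_mul_of_nonneg_left hq hb)
      _ = r := by rw [← add_mul, hab, one_mul]
  have habs : ∀ {p q : ℝ}, |p| ≤ M → |q| ≤ M → |a * p + b * q| ≤ M := fun {p q} hp hq => by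
    refine (abs_add_le _ _).trans ?_
    rw [abs_mul, abs_mul, abs_of_nonneg ha, abs_of_nonneg hb]
    exact hcomb hp hq
  refine ⟨⟨(h.fst.const_mul a).add (h'.fst.const_mul b),
    (h.snd.const_mul a).add (h'.snd.const_mul b), fun x y hxy => ?_⟩,
    fun x => habs (h.abs_fst_le x) (h'.abs_fst_le x),
    fun y => habs (h.abs_snd_le y) (h'.abs_snd_le y), ?_⟩
  · have := hcomb (h.le x y hxy) (h'.le x y hxy)
    linarith
  · rw [integral_add (h.fst.const_mul a) (h'.fst.const_mul b),
      integral_add (h.snd.const_mul a) (h'.snd.const_mul b)]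
    simp only [integral_const_mul]
    have := hcomb (neg_le_neg h.le_value) (neg_le_neg h'.le_value)
    linarith

/-- The almost everywhere limit of functions bounded by `M` has a version which is everywhere
either the limit or the lower bound `-M`. -/
lemma exists_version_of_tendsto_ae {W : Type*} [MeasurableSpace W] {μ : Measure W}
    [IsFiniteMeasure μ] {u : ℕ → W → ℝ} {u' : W → ℝ} (hu : ∀ k, Integrable (u k) μ)
    (hM : ∀ k w, |u k w| ≤ M) (hlim : ∀ᵐ w ∂μ, Tendsto (fun k => u k w) atTop (𝓝 (u' w))) :
    ∃ v, u' =ᵐ[μ] v ∧ Integrable v μ ∧ (∀ w, |v w| ≤ M) ∧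
      Tendsto (fun k => ∫ w, u k w ∂μ) atTop (𝓝 (∫ w, v w ∂μ)) ∧
      ∀ w, Tendsto (fun k => u k w) atTop (𝓝 (v w)) ∨ v w = -M := by
  classical
  let v : W → ℝ := fun w => if Tendsto (fun k => u k w) atTop (𝓝 (u' w)) then u' w else -M
  have hv : ∀ w, Tendsto (fun k => u k w) atTop (𝓝 (v w)) ∨ v w = -M := fun w => by
    by_cases h : Tendsto (fun k => u k w) atTop (𝓝 (u' w))
    · left
      simpa only [v, if_pos h] using h
    · right
      simp only [v, if_neg h]
  have hae : u' =ᵐ[μ] v := by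
    filter_upwards [hlim] with w hw
    simp only [v, if_pos hw]
  have hb : ∀ w, |v w| ≤ M := fun w => by
    rcases hv w with hw | hw
    · exact le_of_tendsto hw.abs (Eventually.of_forall fun k => hM k w)
    · rw [hw, abs_neg, abs_of_nonneg ((abs_nonneg _).trans (hM 0 w))]
  refine ⟨v, hae, Integrable.of_bound ((aestronglyMeasurable_of_tendsto_ae atTop
    (fun k => (hu k).aestronglyMeasurable) hlim).congr hae) M (Eventually.of_forall hb), hb, ?_, hv⟩
  rw [← integral_congr_ae hae]
  exact tendsto_integral_of_dominated_convergence (fun _ => M)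
    (fun k => (hu k).aestronglyMeasurable) (integrable_const _)
    (fun k => Eventually.of_forall (hM k)) hlim

lemma exists_isNearOptimalPair_of_tendsto_ae [IsFiniteMeasure m] [IsFiniteMeasure n]
    (hc0 : ∀ p, 0 ≤ c p) {φ : ℕ → X → ℝ} {ψ : ℕ → Y → ℝ}
    (h : ∀ k, IsNearOptimalPair m n f g c M s (φ k) (ψ k)) {φ' : X → ℝ} {ψ' : Y → ℝ}
    (hφ : ∀ᵐ x ∂m, Tendsto (fun k => φ k x) atTop (𝓝 (φ' x)))
    (hψ : ∀ᵐ y ∂n, Tendsto (fun k => ψ k y) atTop (𝓝 (ψ' y))) :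
    ∃ φ'' ψ'', IsNearOptimalPair m n f g c M s φ'' ψ'' ∧ φ' =ᵐ[m] φ'' ∧ ψ' =ᵐ[n] ψ'' := by
  obtain ⟨v, e1, i1, b1, t1, l1⟩ :=
    exists_version_of_tendsto_ae (fun k => (h k).fst) (fun k => (h k).abs_fst_le) hφ
  obtain ⟨w, e2, i2, b2, t2, l2⟩ :=
    exists_version_of_tendsto_ae (fun k => (h k).snd) (fun k => (h k).abs_snd_le) hψ
  refine ⟨v, w, ⟨⟨i1, i2, fun x y hxy => ?_⟩, b1, b2,
    ge_of_tendsto (t1.add t2) (Eventually.of_forall fun k => (h k).le_value)⟩, e1, e2⟩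
  have h1 := (abs_le.1 (b1 x)).2
  have h2 := (abs_le.1 (b2 y)).2
  have h3 := hc0 (x, y)
  rcases l1 x with hx | hx
  · rcases l2 y with hy | hy
    · exact le_of_tendsto (hx.add hy) (Eventually.of_forall fun k => (h k).le x y hxy)
    · linarith
  · linarith

lemma measurableEmbedding_inl : MeasurableEmbedding (Sum.inl : X → X ⊕ Y) :=
  ⟨Sum.inl_injective, measurable_inl, fun _ hs => measurableSet_inl_image.2 hs⟩

lemma measurableEmbedding_inr : MeasurableEmbedding (Sum.inr : Y → X ⊕ Y) :=
  ⟨Sum.inr_injective, measurable_inr, fun _ hs => measurableSet_inr_image.2 hs⟩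

lemma ae_map_inl_add_map_inr_iff {p : X ⊕ Y → Prop} :
    (∀ᵐ z ∂(m.map Sum.inl + n.map Sum.inr), p z)
      ↔ (∀ᵐ x ∂m, p (Sum.inl x)) ∧ ∀ᵐ y ∂n, p (Sum.inr y) := by
  rw [ae_add_measure_iff, measurableEmbedding_inl.ae_map_iff, measurableEmbedding_inr.ae_map_iff]

/-- If there are near optimal pairs with values arbitrarily close to `s`, then `s` is attained. -/
lemma exists_isNearOptimalPair [IsFiniteMeasure m] [IsFiniteMeasure n]
    (hc0 : ∀ p, 0 ≤ c p) (hM : 0 ≤ M)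
    (h : ∀ r < s, ∃ φ ψ, IsNearOptimalPair m n f g c M r φ ψ) :
    ∃ φ ψ, IsNearOptimalPair m n f g c M s φ ψ := by
  let ρ : Measure (X ⊕ Y) := m.map Sum.inl + n.map Sum.inr
  let K : ℕ → Set (Lp ℝ 2 ρ) := fun k => {u | ∃ φ ψ,
    IsNearOptimalPair m n f g c M (s - 1 / (k + 1)) φ ψ ∧ u =ᵐ[ρ] Sum.elim φ ψ}
  have hpos : ∀ k : ℕ, s - 1 / ((k : ℝ) + 1) < s := fun k => by
    have : (0 : ℝ) < 1 / (k + 1) := by positivity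
    linarith
  obtain ⟨u, hu⟩ : (⋂ k, K k).Nonempty := by
    refine Antitone.nonempty_iInter_of_convex (R := measureUnivNNReal ρ ^ (2 : ℝ≥0∞).toReal⁻¹ * M)
      (fun k l hkl => ?_) (fun k => ?_) (fun k => ?_) (fun k => ?_) ?_
    · rintro u ⟨φ, ψ, H, hu⟩
      refine ⟨φ, ψ, ⟨H.toIsPotentialPair, H.abs_fst_le, H.abs_snd_le, le_trans ?_ H.le_value⟩, hu⟩
      have := one_div_le_one_div_of_le (by positivity : (0 : ℝ) < k + 1)
        (by gcongr : (k : ℝ) + 1 ≤ l + 1)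
      linarith
    · obtain ⟨φ, ψ, H⟩ := h _ (hpos k)
      have hmeas : AEStronglyMeasurable (Sum.elim φ ψ) ρ := by
        refine ⟨Sum.elim (H.fst.aestronglyMeasurable.mk φ) (H.snd.aestronglyMeasurable.mk ψ),
          (Measurable.sumElim H.fst.aestronglyMeasurable.stronglyMeasurable_mk.measurable
          H.snd.aestronglyMeasurable.stronglyMeasurable_mk.measurable).stronglyMeasurable, ?_⟩
        exact ae_map_inl_add_map_inr_iff.2
          ⟨H.fst.aestronglyMeasurable.ae_eq_mk, H.snd.aestronglyMeasurable.ae_eq_mk⟩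
      have hLp : MemLp (Sum.elim φ ψ) 2 ρ := MemLp.of_bound hmeas M
        (ae_map_inl_add_map_inr_iff.2 ⟨Eventually.of_forall H.abs_fst_le,
          Eventually.of_forall H.abs_snd_le⟩)
      exact ⟨hLp.toLp _, φ, ψ, H, hLp.coeFn_toLp⟩
    · refine IsSeqClosed.isClosed fun u u' hu hlim => ?_
      choose φ ψ H hu using hu
      obtain ⟨ns, -, hns⟩ := (tendstoInMeasure_of_tendsto_Lp hlim).exists_seq_tendsto_ae
      have hlim' : ∀ᵐ z ∂ρ, Tendsto (fun i => Sum.elim (φ (ns i)) (ψ (ns i)) z) atTop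
          (𝓝 (u' z)) := by
        filter_upwards [hns, ae_all_iff.2 hu] with z hz hz'
        simpa only [hz'] using hz
      obtain ⟨h1, h2⟩ := ae_map_inl_add_map_inr_iff.1 hlim'
      obtain ⟨φ', ψ', H', e1, e2⟩ :=
        exists_isNearOptimalPair_of_tendsto_ae hc0 (fun i => H (ns i)) h1 h2
      exact ⟨φ', ψ', H', ae_map_inl_add_map_inr_iff.2 ⟨e1, e2⟩⟩
    · rintro u ⟨φ, ψ, H, hu⟩ u' ⟨φ', ψ', H', hu'⟩ a b ha hb hab
      refine ⟨_, _, H.convexComb H' ha hb hab, ?_⟩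
      filter_upwards [Lp.coeFn_add (a • u) (b • u'), Lp.coeFn_smul a u, Lp.coeFn_smul b u', hu, hu']
        with z h1 h2 h3 h4 h5
      rw [h1, Pi.add_apply, h2, h3, Pi.smul_apply, Pi.smul_apply, h4, h5]
      cases z <;> simp
    · rintro u ⟨φ, ψ, H, hu⟩
      refine Lp.norm_le_of_ae_bound hM ?_
      have : ∀ᵐ z ∂ρ, ‖Sum.elim φ ψ z‖ ≤ M := ae_map_inl_add_map_inr_iff.2
        ⟨Eventually.of_forall H.abs_fst_le, Eventually.of_forall H.abs_snd_le⟩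
      filter_upwards [hu, this] with z hz hz'
      rwa [hz]
  have hu' := mem_iInter.1 hu
  choose φ ψ H hae using hu'
  have h1 : ∀ k, φ k =ᵐ[m] φ 0 := fun k =>
    (ae_map_inl_add_map_inr_iff.1 ((hae k).symm.trans (hae 0))).1
  have h2 : ∀ k, ψ k =ᵐ[n] ψ 0 := fun k =>
    (ae_map_inl_add_map_inr_iff.1 ((hae k).symm.trans (hae 0))).2
  refine ⟨φ 0, ψ 0, (H 0).toIsPotentialPair, (H 0).abs_fst_le, (H 0).abs_snd_le, ?_⟩
  have hlim : Tendsto (fun k : ℕ => s - 1 / ((k : ℝ) + 1)) atTop (𝓝 (s - 0)) :=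
    tendsto_one_div_add_atTop_nhds_zero_nat.const_sub s
  rw [sub_zero] at hlim
  refine le_of_tendsto hlim (Eventually.of_forall fun k => ?_)
  rw [← integral_congr_ae (h1 k), ← integral_congr_ae (h2 k)]
  exact (H k).le_value

end Maximizer

lemma IsFiberCoupling.map_eq_map {X Y Z : Type*} [MeasurableSpace X] [MeasurableSpace Y]
    [MeasurableSpace Z] {m : Measure X} {n : Measure Y} {f : X → Z} {g : Y → Z}
    {π : Measure (X × Y)} (hπ : IsFiberCoupling m n f g π) (hf : Measurable f)
    (hg : Measurable g) : m.map f = n.map g := by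
  rw [← hπ.fst, ← hπ.snd, Measure.fst, Measure.snd, Measure.map_map hf measurable_fst,
    Measure.map_map hg measurable_snd]
  exact Measure.map_congr hπ.ae_eq

/-- Duality with attainment for optimal transport constrained to a fibre product. -/
theorem IsFiberCoupling.exists_integral_eq {X Y Z : Type*}
    [MeasurableSpace X] [MetricSpace X] [PolishSpace X] [BorelSpace X]
    [MeasurableSpace Y] [MetricSpace Y] [PolishSpace Y] [BorelSpace Y]
    [MeasurableSpace Z] [MeasurableSpace.CountablySeparated Z] [MeasurableEq Z]
    {m : Measure X} {n : Measure Y} [IsProbabilityMeasure m] [IsProbabilityMeasure n]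
    {f : X → Z} {g : Y → Z} (hf : Measurable f) (hg : Measurable g) {π₀ : Measure (X × Y)}
    (hπ₀ : IsFiberCoupling m n f g π₀) {c : X × Y → ℝ} (hc : UniformContinuous c)
    (hc0 : ∀ p, 0 ≤ c p) {M : ℝ} (hcM : ∀ p, c p ≤ M) :
    ∃ π φ ψ, IsFiberCoupling m n f g π ∧ IsPotentialPair m n f g c φ ψ ∧
      ∫ p, c p ∂π = ∫ x, φ x ∂m + ∫ y, ψ y ∂n := by
  have habs : ∀ p, |c p| ≤ M := fun p => by rw [abs_of_nonneg (hc0 p)]; exact hcM p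
  have hM : 0 ≤ M := by
    obtain ⟨x⟩ := m.nonempty_of_neZero
    obtain ⟨y⟩ := n.nonempty_of_neZero
    exact (hc0 (x, y)).trans (hcM _)
  obtain ⟨L, hL, hLc⟩ := hπ₀.exists_dominatesDual (c := c) ⟨M, habs⟩
  obtain ⟨π, h1, h2, hπ⟩ := hL.exists_coupling
  have : IsProbabilityMeasure π := ⟨by rw [← Measure.fst_univ, h1, measure_univ]⟩
  have hcoup : IsFiberCoupling m n f g π := ⟨h1, h2, hL.ae_eq_of_rectangles hf hg hπ⟩
  rw [hL.map_eq_integral_of_uniformContinuous hπ hc habs] at hLc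
  obtain ⟨φ, ψ, H⟩ := exists_isNearOptimalPair (m := m) (n := n) (f := f) (g := g)
    (s := ∫ p, c p ∂π) hc0 hM fun r hr => by
      rw [hLc] at hr
      obtain ⟨_, ⟨φ, ψ, H, rfl⟩, hlt⟩ := exists_lt_of_lt_csSup (dualValues_nonempty ⟨M, habs⟩) hr
      obtain ⟨φ', ψ', H', b1, b2, hle⟩ :=
        H.exists_bounded hf hg (hπ₀.map_eq_map hf hg) hc0 hcM
      exact ⟨φ', ψ', H', b1, b2, hlt.le.trans hle⟩
  refine ⟨π, φ, ψ, hcoup, H.toIsPotentialPair, le_antisymm H.le_value ?_⟩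
  exact hcoup.dualValue_le (hc.continuous.measurable.integrable_of_abs_le habs) (fun p => le_rfl)
    ⟨φ, ψ, H.toIsPotentialPair, rfl⟩

section TuplesOfMeasures

variable {X Y : Type*} [MeasurableSpace X] [MeasurableSpace Y] {d : ℕ}
  (μ : Fin d → Measure X) (ν : Fin d → Measure Y)

instance isProbabilityMeasure_avgProb [NeZero d] [∀ j, IsProbabilityMeasure (μ j)] :
    IsProbabilityMeasure (avgProb μ) := ⟨by
  simp [avgProb, ENNReal.inv_mul_cancel, NeZero.ne d]⟩

lemma le_smul_avgProb [NeZero d] (j : Fin d) : μ j ≤ (d : ℝ≥0∞) • avgProb μ := by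
  rw [avgProb, smul_smul, ENNReal.mul_inv_cancel (by simp [NeZero.ne d]) (by simp), one_smul]
  exact Finset.single_le_sum (f := μ) (fun _ _ => Measure.zero_le _) (Finset.mem_univ j)

lemma absolutelyContinuous_avgProb [NeZero d] (j : Fin d) : μ j ≪ avgProb μ :=
  Measure.absolutelyContinuous_of_le_smul (le_smul_avgProb μ j)

lemma measurable_densityVec : Measurable (densityVec μ) :=
  measurable_pi_lambda _ fun j => (Measure.measurable_rnDeriv (μ j) (avgProb μ)).ennreal_toReal

lemma measurable_densityVec_apply (j : Fin d) : Measurable fun x => densityVec μ x j :=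
  (measurable_pi_apply j).comp (measurable_densityVec μ)

variable [∀ j, IsProbabilityMeasure (μ j)] [∀ j, IsProbabilityMeasure (ν j)]

lemma ae_abs_densityVec_le [NeZero d] (j : Fin d) : ∀ᵐ x ∂(avgProb μ), |densityVec μ x j| ≤ d := by
  have h : (μ j).rnDeriv (avgProb μ) ≤ᵐ[avgProb μ] fun _ => (d : ℝ≥0∞) := by
    refine ae_le_of_forall_setLIntegral_le_of_sigmaFinite (Measure.measurable_rnDeriv _ _)
      fun s hs _ => ?_
    rw [Measure.setLIntegral_rnDeriv (absolutelyContinuous_avgProb μ j), setLIntegral_const]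
    exact le_smul_avgProb μ j s
  filter_upwards [h] with x hx
  rw [densityVec, abs_of_nonneg toReal_nonneg]
  exact toReal_le_of_le_ofReal (Nat.cast_nonneg d) (by simpa using hx)

lemma integral_densityVec_mul [NeZero d] (j : Fin d) (h : X → ℝ) :
    ∫ x, densityVec μ x j * h x ∂(avgProb μ) = ∫ x, h x ∂(μ j) :=
  integral_rnDeriv_smul (absolutelyContinuous_avgProb μ j)

lemma lintegral_densityVec_mul [NeZero d] (j : Fin d) {h : X → ℝ≥0∞} (hh : Measurable h) :
    ∫⁻ x, ENNReal.ofReal (densityVec μ x j) * h x ∂(avgProb μ) = ∫⁻ x, h x ∂(μ j) := by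
  rw [← lintegral_rnDeriv_mul (absolutelyContinuous_avgProb μ j) hh.aemeasurable]
  refine lintegral_congr_ae ?_
  filter_upwards [Measure.rnDeriv_lt_top (μ j) (avgProb μ)] with x hx
  rw [densityVec, ofReal_toReal hx.ne]

variable {μ ν}

omit [∀ j, IsProbabilityMeasure (μ j)] [∀ j, IsProbabilityMeasure (ν j)] in
lemma bind_avgProb (κ : Kernel X Y) (h : ∀ j, (μ j).bind κ = ν j) :
    (avgProb μ).bind κ = avgProb ν := by
  ext B hB
  rw [Measure.bind_apply hB κ.measurable.aemeasurable, avgProb, avgProb, lintegral_smul_measure,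
    lintegral_finsetSum_measure, Measure.smul_apply, Measure.finsetSum_apply]
  congr 2 with j
  rw [← h j, Measure.bind_apply hB κ.measurable.aemeasurable]

lemma integrable_sq_sub_densityVec [NeZero d] {π : Measure (X × Y)} (h1 : π.fst = avgProb μ)
    (h2 : π.snd = avgProb ν) (j : Fin d) :
    Integrable (fun p : X × Y => (densityVec μ p.1 j - densityVec ν p.2 j) ^ 2) π := by
  have : IsProbabilityMeasure π := ⟨by rw [← Measure.fst_univ, h1, measure_univ]⟩
  refine Integrable.of_bound (C := (d + d) ^ 2) ?_ ?_
  · exact ((((measurable_densityVec_apply μ j).comp measurable_fst).sub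
      ((measurable_densityVec_apply ν j).comp measurable_snd)).pow_const 2).aestronglyMeasurable
  · have b1 := ae_of_ae_map measurable_fst.aemeasurable (h1 ▸ ae_abs_densityVec_le μ j)
    have b2 := ae_of_ae_map measurable_snd.aemeasurable (h2 ▸ ae_abs_densityVec_le ν j)
    filter_upwards [b1, b2] with p hp1 hp2
    rw [Real.norm_eq_abs, abs_pow]
    exact pow_le_pow_left₀ (abs_nonneg _) ((abs_sub _ _).trans (add_le_add hp1 hp2)) 2

/-- A simultaneous transport plan couples the averages, and the squared distance of the density
vectors is the difference of their second moments. -/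
lemma integral_sq_sub_densityVec_of_mem_piSet [NeZero d] {π : Measure (X × Y)}
    (hπ : π ∈ PiSet μ ν) :
    π.fst = avgProb μ ∧ π.snd = avgProb ν ∧ ∀ j,
      ∫ p, (densityVec μ p.1 j - densityVec ν p.2 j) ^ 2 ∂π
        = ∫ x, densityVec μ x j ^ 2 ∂(avgProb μ) - ∫ y, densityVec ν y j ^ 2 ∂(avgProb ν) := by
  obtain ⟨κ, hκ, hle, rfl⟩ := hπ
  have hbind : ∀ j, (μ j).bind κ = ν j := fun j => by
    have : IsProbabilityMeasure ((μ j).bind κ) := by infer_instance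
    refine (Measure.eq_of_le_of_isProbabilityMeasure (Measure.le_iff.2 fun B hB => ?_)).symm
    rw [Measure.bind_apply hB κ.measurable.aemeasurable]
    exact hle j B hB
  have h1 : ((avgProb μ) ⊗ₘ κ).fst = avgProb μ := Measure.fst_compProd _ _
  have h2 : ((avgProb μ) ⊗ₘ κ).snd = avgProb ν := by
    rw [Measure.snd_compProd]
    exact bind_avgProb κ hbind
  refine ⟨h1, h2, fun j => ?_⟩
  have m1 : Measurable fun p : X × Y => densityVec μ p.1 j :=
    (measurable_densityVec_apply μ j).comp measurable_fst
  have m2 : Measurable fun p : X × Y => densityVec ν p.2 j :=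
    (measurable_densityVec_apply ν j).comp measurable_snd
  have b1 := ae_of_ae_map measurable_fst.aemeasurable
    (h1.symm ▸ ae_abs_densityVec_le μ j : ∀ᵐ x ∂((avgProb μ) ⊗ₘ κ).fst, |densityVec μ x j| ≤ d)
  have b2 := ae_of_ae_map measurable_snd.aemeasurable
    (h2.symm ▸ ae_abs_densityVec_le ν j : ∀ᵐ y ∂((avgProb μ) ⊗ₘ κ).snd, |densityVec ν y j| ≤ d)
  have i1 : Integrable (fun p : X × Y => densityVec μ p.1 j) ((avgProb μ) ⊗ₘ κ) :=
    Integrable.of_bound m1.aestronglyMeasurable d b1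
  have i11 : Integrable (fun p : X × Y => densityVec μ p.1 j ^ 2) ((avgProb μ) ⊗ₘ κ) := by
    simp only [sq]
    exact i1.bdd_mul m1.aestronglyMeasurable b1
  have i2 : Integrable (fun p : X × Y => densityVec ν p.2 j) ((avgProb μ) ⊗ₘ κ) :=
    Integrable.of_bound m2.aestronglyMeasurable d b2
  have i22 : Integrable (fun p : X × Y => densityVec ν p.2 j ^ 2) ((avgProb μ) ⊗ₘ κ) := by
    simp only [sq]
    exact i2.bdd_mul m2.aestronglyMeasurable b2
  have i12 : Integrable (fun p : X × Y => densityVec μ p.1 j * densityVec ν p.2 j)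
      ((avgProb μ) ⊗ₘ κ) := i2.bdd_mul m1.aestronglyMeasurable b1
  have e1 : ∫ p, densityVec μ p.1 j ^ 2 ∂((avgProb μ) ⊗ₘ κ)
      = ∫ x, densityVec μ x j ^ 2 ∂(avgProb μ) := by
    conv_rhs => rw [← h1]
    exact (integral_map measurable_fst.aemeasurable
      ((measurable_densityVec_apply μ j).pow_const 2).aestronglyMeasurable).symm
  have e2 : ∫ p, densityVec ν p.2 j ^ 2 ∂((avgProb μ) ⊗ₘ κ)
      = ∫ y, densityVec ν y j ^ 2 ∂(avgProb ν) := by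
    conv_rhs => rw [← h2]
    exact (integral_map measurable_snd.aemeasurable
      ((measurable_densityVec_apply ν j).pow_const 2).aestronglyMeasurable).symm
  have e12 : ∫ p, densityVec μ p.1 j * densityVec ν p.2 j ∂((avgProb μ) ⊗ₘ κ)
      = ∫ y, densityVec ν y j ^ 2 ∂(avgProb ν) := by
    have hs : ((μ j) ⊗ₘ κ).map Prod.snd = ν j := by
      rw [← hbind j]
      exact Measure.snd_compProd _ _
    have hb : ∀ᵐ y ∂(ν j), |densityVec ν y j| ≤ d :=
      (absolutelyContinuous_avgProb ν j).ae_le (ae_abs_densityVec_le ν j)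
    rw [Measure.integral_compProd i12]
    simp only [integral_const_mul, sq]
    rw [integral_densityVec_mul μ j fun x => ∫ y, densityVec ν y j ∂(κ x),
      integral_densityVec_mul ν j fun y => densityVec ν y j,
      ← Measure.integral_compProd (f := fun p : X × Y => densityVec ν p.2 j)
        (Integrable.of_bound m2.aestronglyMeasurable d
          (ae_of_ae_map measurable_snd.aemeasurable (hs.symm ▸ hb)))]
    conv_rhs => rw [← hs]
    exact (integral_map measurable_snd.aemeasurable
      (measurable_densityVec_apply ν j).aestronglyMeasurable).symm
  have hexp : ∀ p : X × Y, (densityVec μ p.1 j - densityVec ν p.2 j) ^ 2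
      = densityVec μ p.1 j ^ 2 - 2 * (densityVec μ p.1 j * densityVec ν p.2 j)
        + densityVec ν p.2 j ^ 2 := fun p => by ring
  have hsub : Integrable (fun p : X × Y => densityVec μ p.1 j ^ 2
      - 2 * (densityVec μ p.1 j * densityVec ν p.2 j)) ((avgProb μ) ⊗ₘ κ) :=
    i11.sub (i12.const_mul 2)
  simp only [hexp]
  rw [integral_add hsub i22, integral_sub i11 (i12.const_mul 2),
    integral_const_mul, e1, e2, e12]
  ring

/-- If transport is possible in both directions, simultaneous transport plans preserve the density
vectors. -/
lemma isFiberCoupling_of_mem_piSet [NeZero d] (hbwd : (PiSet ν μ).Nonempty) {π : Measure (X × Y)}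
    (hπ : π ∈ PiSet μ ν) :
    IsFiberCoupling (avgProb μ) (avgProb ν) (densityVec μ) (densityVec ν) π := by
  obtain ⟨π', hπ'⟩ := hbwd
  obtain ⟨h1, h2, h⟩ := integral_sq_sub_densityVec_of_mem_piSet hπ
  obtain ⟨-, -, h'⟩ := integral_sq_sub_densityVec_of_mem_piSet hπ'
  refine ⟨h1, h2, ?_⟩
  have key : ∀ j, ∀ᵐ p ∂π, densityVec μ p.1 j = densityVec ν p.2 j := fun j => by
    have h0 : 0 ≤ ∫ p, (densityVec ν p.1 j - densityVec μ p.2 j) ^ 2 ∂π' :=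
      integral_nonneg fun p => sq_nonneg _
    have h0' : 0 ≤ ∫ p, (densityVec μ p.1 j - densityVec ν p.2 j) ^ 2 ∂π :=
      integral_nonneg fun p => sq_nonneg _
    have hz : ∫ p, (densityVec μ p.1 j - densityVec ν p.2 j) ^ 2 ∂π = 0 := by
      linarith [h j, h' j]
    filter_upwards [(integral_eq_zero_iff_of_nonneg (fun p => sq_nonneg _)
      (integrable_sq_sub_densityVec h1 h2 j)).1 hz] with p hp
    exact sub_eq_zero.1 (pow_eq_zero_iff two_ne_zero |>.1 hp)
  filter_upwards [ae_all_iff.2 key] with p hp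
  exact funext hp

lemma IsFiberCoupling.mem_piSet [NeZero d] [StandardBorelSpace Y] {π : Measure (X × Y)}
    (hπ : IsFiberCoupling (avgProb μ) (avgProb ν) (densityVec μ) (densityVec ν) π) :
    π ∈ PiSet μ ν := by
  have := hπ.isProbabilityMeasure
  have : Nonempty Y := (avgProb ν).nonempty_of_neZero
  have hdis : (avgProb μ) ⊗ₘ π.condKernel = π := by
    rw [← hπ.fst]
    exact π.disintegrate π.condKernel
  refine ⟨π.condKernel, inferInstance, fun j B hB => le_of_eq ?_, hdis.symm⟩
  have hBm : Measurable (B.indicator (1 : Y → ℝ≥0∞)) := measurable_one.indicator hB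
  have m1 : Measurable fun p : X × Y => ENNReal.ofReal (densityVec μ p.1 j) :=
    ((measurable_densityVec_apply μ j).comp measurable_fst).ennreal_ofReal
  calc ν j B = ∫⁻ y, B.indicator 1 y ∂(ν j) := (lintegral_indicator_one hB).symm
    _ = ∫⁻ y, ENNReal.ofReal (densityVec ν y j) * B.indicator 1 y ∂(avgProb ν) :=
      (lintegral_densityVec_mul ν j hBm).symm
    _ = ∫⁻ p, ENNReal.ofReal (densityVec ν p.2 j) * B.indicator 1 p.2 ∂π := by
      rw [← hπ.snd, Measure.snd]
      exact lintegral_map ((measurable_densityVec_apply ν j).ennreal_ofReal.mul hBm) measurable_snd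
    _ = ∫⁻ p, ENNReal.ofReal (densityVec μ p.1 j) * B.indicator 1 p.2 ∂π := by
      refine lintegral_congr_ae ?_
      filter_upwards [hπ.ae_eq] with p hp
      rw [hp]
    _ = ∫⁻ x, ∫⁻ y, ENNReal.ofReal (densityVec μ x j) * B.indicator 1 y ∂(π.condKernel x)
          ∂(avgProb μ) := by
      conv_lhs => rw [← hdis]
      exact Measure.lintegral_compProd (m1.mul (hBm.comp measurable_snd))
    _ = ∫⁻ x, ENNReal.ofReal (densityVec μ x j) * π.condKernel x B ∂(avgProb μ) := by
      refine lintegral_congr fun x => ?_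
      rw [lintegral_const_mul _ hBm, lintegral_indicator_one hB]
    _ = ∫⁻ x, π.condKernel x B ∂(μ j) :=
      lintegral_densityVec_mul μ j (Kernel.measurable_coe _ hB)

end TuplesOfMeasures

/-- two-way duality: if `Π(μ,ν)` and `Π(ν,μ)` are nonempty and `c` is
uniformly continuous, bounded and nonnegative, duality holds with both the infimum and
the supremum attained. -/
theorem sot_two_way_duality
    {X Y : Type*} [MeasurableSpace X] [MetricSpace X] [PolishSpace X] [BorelSpace X]
    [MeasurableSpace Y] [MetricSpace Y] [PolishSpace Y] [BorelSpace Y]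
    {d : ℕ} (μ : Fin d → Measure X) (ν : Fin d → Measure Y)
    (hμ : ∀ j, IsProbabilityMeasure (μ j)) (hν : ∀ j, IsProbabilityMeasure (ν j))
    (hfwd : (PiSet μ ν).Nonempty) (hbwd : (PiSet ν μ).Nonempty)
    (c : X × Y → ℝ) (hc : UniformContinuous c) (hc0 : ∀ p, 0 ≤ c p)
    (hcbdd : ∃ M : ℝ, ∀ p, c p ≤ M) :
    sInf {r : ℝ | ∃ π ∈ PiSet μ ν, r = ∫ p, c p ∂π}
        = sSup {r : ℝ | ∃ φ ψ, DualAdmissible μ ν c φ ψ ∧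
            r = ∫ x, φ x ∂(avgProb μ) + ∫ y, ψ y ∂(avgProb ν)} ∧
      (∃ π ∈ PiSet μ ν,
        ∫ p, c p ∂π = sInf {r : ℝ | ∃ π' ∈ PiSet μ ν, r = ∫ p, c p ∂π'}) ∧
      (∃ φ ψ, DualAdmissible μ ν c φ ψ ∧
        ∫ x, φ x ∂(avgProb μ) + ∫ y, ψ y ∂(avgProb ν)
          = sSup {r : ℝ | ∃ φ' ψ', DualAdmissible μ ν c φ' ψ' ∧
              r = ∫ x, φ' x ∂(avgProb μ) + ∫ y, ψ' y ∂(avgProb ν)}) := by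
  have key : ∃ t, IsLeast {r : ℝ | ∃ π ∈ PiSet μ ν, r = ∫ p, c p ∂π} t ∧
      IsGreatest {r : ℝ | ∃ φ ψ, DualAdmissible μ ν c φ ψ ∧
        r = ∫ x, φ x ∂(avgProb μ) + ∫ y, ψ y ∂(avgProb ν)} t := by
    obtain ⟨M, hM⟩ := hcbdd
    rcases eq_or_ne d 0 with rfl | hd
    · have hμ0 : avgProb μ = 0 := by simp [avgProb]
      have hν0 : avgProb ν = 0 := by simp [avgProb]
      have hπ0 : ∀ π ∈ PiSet μ ν, ∫ p, c p ∂π = 0 := by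
        rintro π ⟨κ, -, -, rfl⟩
        simp [hμ0]
      obtain ⟨π, hπ⟩ := hfwd
      refine ⟨0, ⟨⟨π, hπ, (hπ0 π hπ).symm⟩, ?_⟩, ⟨⟨0, 0, ⟨integrable_zero _ _ _,
        integrable_zero _ _ _, fun x y _ => by simpa using hc0 (x, y)⟩, by simp⟩, ?_⟩⟩
      · rintro _ ⟨π', hπ', rfl⟩
        exact (hπ0 π' hπ').ge
      · rintro _ ⟨φ, ψ, -, rfl⟩
        simp [hμ0, hν0]
    · have : NeZero d := ⟨hd⟩
      have habs : ∀ p, |c p| ≤ M := fun p => by rw [abs_of_nonneg (hc0 p)]; exact hM p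
      obtain ⟨π₀, hπ₀⟩ := hfwd
      obtain ⟨π, φ, ψ, hπ, H, heq⟩ := (isFiberCoupling_of_mem_piSet hbwd hπ₀).exists_integral_eq
        (measurable_densityVec μ) (measurable_densityVec ν) hc hc0 hM
      have hweak : ∀ π' ∈ PiSet μ ν, ∀ φ' ψ', DualAdmissible μ ν c φ' ψ' →
          ∫ x, φ' x ∂(avgProb μ) + ∫ y, ψ' y ∂(avgProb ν) ≤ ∫ p, c p ∂π' := by
        rintro π' hπ' φ' ψ' ⟨h1, h2, h3⟩
        have hcoup := isFiberCoupling_of_mem_piSet hbwd hπ'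
        have := hcoup.isProbabilityMeasure
        exact hcoup.dualValue_le (hc.continuous.measurable.integrable_of_abs_le habs)
          (fun p => le_rfl) ⟨φ', ψ', ⟨h1, h2, h3⟩, rfl⟩
      have hadm : DualAdmissible μ ν c φ ψ := ⟨H.fst, H.snd, H.le⟩
      refine ⟨∫ p, c p ∂π, ⟨⟨π, hπ.mem_piSet, rfl⟩, ?_⟩, ⟨⟨φ, ψ, hadm, heq⟩, ?_⟩⟩
      · rintro _ ⟨π', hπ', rfl⟩
        rw [heq]
        exact hweak π' hπ' φ ψ hadm
      · rintro _ ⟨φ', ψ', h', rfl⟩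
        exact hweak π hπ.mem_piSet φ' ψ' h'
  obtain ⟨t, hleast, hgreatest⟩ := key
  rw [hleast.csInf_eq, hgreatest.csSup_eq]
  obtain ⟨π, hπ, hπt⟩ := hleast.1
  obtain ⟨φ, ψ, H, hφψ⟩ := hgreatest.1
  exact ⟨rfl, ⟨π, hπ, hπt.symm⟩, ⟨φ, ψ, H, hφψ.symm⟩⟩

end
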